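/- arXiv:2405.04094 — 4 statements merged into one kernel-verified Lean document; each statement's English description precedes it below -/
import Mathlib

section
/- There exist an absolute constant C and a threshold x0 such that the following holds for every real x ≥ x0. Set Q = exp((log x)^{1/3}) and X = exp((log x)^{1/100}), and let P be any real with 2 ≤ P ≤ exp((log x)^{1/6}). Then Σ_{Q < m ≤ x, every prime factor of m is > P} (X/m) · ∫_m^{(1+1/X)m} (x/m − x/t + 1) dt ≤ C · x / log P. -/
open Finset in
/-- The `P`-rough positive integers up to `x`. -/
noncomputable def roughSet (x P : ℝ) : Finset ℕ :=
  (Finset.Ioc 0 ⌊x⌋₊).filter (fun m => ∀ p : ℕ, p ∈ m.primeFactors → P < (p : ℝ))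

lemma mem_roughSet {x P : ℝ} {m : ℕ} : m ∈ roughSet x P ↔
    (0 < m ∧ m ≤ ⌊x⌋₊) ∧ ∀ p : ℕ, p ∈ m.primeFactors → P < (p : ℝ) := by
  simp [roughSet]

lemma rough_coprime {P : ℝ} {m n : ℕ} (hn : 0 < n) (hnP : (n : ℝ) ≤ P) (hm0 : 0 < m)
    (hm : ∀ p : ℕ, p ∈ m.primeFactors → P < (p : ℝ)) : Nat.Coprime m n := by
  refine Nat.Coprime.symm (Nat.coprime_of_dvd ?_)
  intro p hp hpn hpm
  have h1 := hm p (Nat.mem_primeFactors.2 ⟨hp, hpm, hm0.ne'⟩)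
  have h2 : (p : ℝ) ≤ n := by exact_mod_cast Nat.le_of_dvd hn hpn
  linarith

lemma rough_recip {x P : ℝ} (hx : 1 ≤ x) (hP : 2 ≤ P) :
    (∑ m ∈ roughSet x P, (m : ℝ)⁻¹) * Real.log P ≤ 1 + Real.log (x * P) := by
  have hxP : 1 ≤ x * P := by nlinarith
  have h1 := log_le_harmonic_floor P (by linarith)
  have h2 := harmonic_floor_le_one_add_log (x * P) hxP
  rw [harmonic_eq_sum_Icc] at h1 h2
  push_cast at h1 h2
  refine le_trans ?_ h2
  refine le_trans (mul_le_mul_of_nonneg_left h1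
    (Finset.sum_nonneg fun m _ => by positivity)) ?_
  rw [Finset.sum_mul_sum, ← Finset.sum_product']
  have hinj : Set.InjOn (fun q : ℕ × ℕ => q.1 * q.2)
      ((roughSet x P ×ˢ Finset.Icc 1 ⌊P⌋₊ : Finset (ℕ × ℕ)) : Set (ℕ × ℕ)) := by
    rintro ⟨m, n⟩ h ⟨m', n'⟩ h' heq
    simp only [Finset.coe_product, Set.mem_prod, Finset.mem_coe, Finset.mem_Icc,
      mem_roughSet] at h h' heq
    have hn : (n : ℝ) ≤ P := (Nat.le_floor_iff (by linarith)).1 h.2.2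
    have hn' : (n' : ℝ) ≤ P := (Nat.le_floor_iff (by linarith)).1 h'.2.2
    have c1 : Nat.Coprime m n' := rough_coprime h'.2.1 hn' h.1.1.1 h.1.2
    have c2 : Nat.Coprime m' n := rough_coprime h.2.1 hn h'.1.1.1 h'.1.2
    have d1 : m ∣ m' := c1.dvd_of_dvd_mul_right (heq ▸ Dvd.intro _ rfl)
    have d2 : m' ∣ m := c2.dvd_of_dvd_mul_right (heq ▸ Dvd.intro _ rfl)
    have e : m = m' := Nat.dvd_antisymm d1 d2
    subst e
    have := Nat.eq_of_mul_eq_mul_left h.1.1.1 heq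
    simp [this]
  have : ∑ q ∈ roughSet x P ×ˢ Finset.Icc 1 ⌊P⌋₊, ((q.1 : ℝ)⁻¹ * (q.2 : ℝ)⁻¹)
      = ∑ k ∈ (roughSet x P ×ˢ Finset.Icc 1 ⌊P⌋₊).image (fun q : ℕ × ℕ => q.1 * q.2),
        (k : ℝ)⁻¹ := by
    rw [Finset.sum_image hinj]
    refine Finset.sum_congr rfl fun q _ => ?_
    push_cast
    rw [mul_inv]
  rw [this]
  refine Finset.sum_le_sum_of_subset_of_nonneg ?_ fun k _ _ => by positivity
  intro k hk
  obtain ⟨⟨m, n⟩, h, rfl⟩ := Finset.mem_image.1 hk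
  simp only [Finset.mem_product, Finset.mem_Icc, mem_roughSet] at h ⊢
  refine ⟨Nat.mul_pos h.1.1.1 h.2.1, ?_⟩
  have hn : (n : ℝ) ≤ P := (Nat.le_floor_iff (by linarith)).1 h.2.2
  have hm : (m : ℝ) ≤ x := (Nat.le_floor_iff (by linarith)).1 h.1.1.2
  rw [Nat.le_floor_iff (by linarith)]
  push_cast
  gcongr

open ArithmeticFunction in
lemma rough_log {x P : ℝ} (hx : 1 ≤ x) :
    ∑ m ∈ roughSet x P, Real.log m ≤ ∑ k ∈ roughSet x P, Chebyshev.psi (x / k) := by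
  have h1 : ∑ m ∈ roughSet x P, Real.log m
      = ∑ m ∈ roughSet x P, ∑ d ∈ m.divisors, vonMangoldt (m / d) := by
    refine Finset.sum_congr rfl fun m _ => ?_
    rw [Nat.sum_div_divisors m (fun d => vonMangoldt d), vonMangoldt_sum]
  rw [h1, Finset.sum_comm' (t' := roughSet x P)
    (s' := fun k => (roughSet x P).filter (fun m => k ∣ m))]
  · refine Finset.sum_le_sum fun k hk => ?_
    have hk' := mem_roughSet.1 hk
    have hk0 : (0 : ℝ) < k := by exact_mod_cast hk'.1.1
    unfold Chebyshev.psi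
    have hinj : Set.InjOn (fun m : ℕ => m / k)
        (((roughSet x P).filter (fun m => k ∣ m) : Finset ℕ) : Set ℕ) := by
      intro a ha b hb hab
      simp only [Finset.coe_filter, Set.mem_setOf_eq] at ha hb hab
      rw [← Nat.div_mul_cancel ha.2, ← Nat.div_mul_cancel hb.2, hab]
    rw [← Finset.sum_image (f := fun j => vonMangoldt j) hinj]
    refine Finset.sum_le_sum_of_subset_of_nonneg ?_ fun j _ _ => vonMangoldt_nonneg
    intro j hj
    obtain ⟨m, hm, rfl⟩ := Finset.mem_image.1 hj
    rw [Finset.mem_filter, mem_roughSet] at hm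
    rw [Finset.mem_Ioc]
    refine ⟨Nat.div_pos (Nat.le_of_dvd hm.1.1.1 hm.2) hk'.1.1, ?_⟩
    have hmx : (m : ℝ) ≤ x := (Nat.le_floor_iff (by linarith)).1 hm.1.1.2
    rw [Nat.le_floor_iff (by positivity), Nat.cast_div hm.2 hk0.ne']
    gcongr
  · intro m k
    simp only [Finset.mem_filter, mem_roughSet, Nat.mem_divisors]
    constructor
    · rintro ⟨hm, hkm, hm0⟩
      refine ⟨⟨hm, hkm⟩, ⟨Nat.pos_of_dvd_of_pos hkm hm.1.1,
        (Nat.le_of_dvd hm.1.1 hkm).trans hm.1.2⟩, ?_⟩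
      intro p hp
      exact hm.2 p (Nat.primeFactors_mono hkm hm0 hp)
    · rintro ⟨⟨hm, hkm⟩, _⟩
      exact ⟨hm, hkm, hm.1.1.ne'⟩

lemma rough_card {x P : ℝ} (hx : 1 ≤ x) :
    ((roughSet x P).card : ℝ) * Real.log x
      ≤ (Real.log 4 + 5) * x * ∑ m ∈ roughSet x P, (m : ℝ)⁻¹ := by
  have h1 : ∀ m ∈ roughSet x P, Real.log x ≤ Real.log m + x * (m : ℝ)⁻¹ := by
    intro m hm
    have hm0 : (0 : ℝ) < m := by exact_mod_cast (mem_roughSet.1 hm).1.1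
    have h := Real.log_le_sub_one_of_pos (show 0 < x / m by positivity)
    rw [Real.log_div (by positivity) (by positivity), div_eq_mul_inv] at h
    linarith
  have h2 := Finset.sum_le_sum h1
  rw [Finset.sum_const, nsmul_eq_mul, Finset.sum_add_distrib, ← Finset.mul_sum] at h2
  have h3 := rough_log (P := P) hx
  have h4 : ∑ k ∈ roughSet x P, Chebyshev.psi (x / k)
      ≤ ∑ k ∈ roughSet x P, (Real.log 4 + 4) * x * (k : ℝ)⁻¹ := by
    refine Finset.sum_le_sum fun k _ => ?_
    have := Chebyshev.psi_le_const_mul_self (show 0 ≤ x / k by positivity)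
    rw [div_eq_mul_inv, ← mul_assoc] at this
    rwa [div_eq_mul_inv]
  rw [← Finset.mul_sum] at h4
  linarith

lemma term_bound {x X : ℝ} {m : ℕ} (hx : 0 < x) (hX : 0 < X) (hm : 0 < m) :
    (X / m) * ∫ t in (m : ℝ)..((1 + 1 / X) * m), (x / m - x / t + 1)
      ≤ x / X * (m : ℝ)⁻¹ + 1 := by
  have hm0 : (0 : ℝ) < m := by exact_mod_cast hm
  have hle : (m : ℝ) ≤ (1 + 1 / X) * m := by
    have : 0 < 1 / X * m := by positivity
    linarith
  have hI : ∫ t in (m : ℝ)..((1 + 1 / X) * m), (x / m - x / t + 1)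
      ≤ ∫ t in (m : ℝ)..((1 + 1 / X) * m), (x / X * (m : ℝ)⁻¹ + 1) := by
    apply intervalIntegral.integral_mono_on hle
    · apply ContinuousOn.intervalIntegrable
      rw [Set.uIcc_of_le hle]
      intro t ht
      have : t ≠ 0 := by linarith [ht.1]
      apply ContinuousAt.continuousWithinAt
      fun_prop (disch := assumption)
    · simp
    · intro t ht
      have ht0 : 0 < t := by linarith [ht.1]
      have e : x / m - x / t = x * (t - m) / (m * t) := by field_simp
      have : x / m - x / t ≤ x / X * (m : ℝ)⁻¹ := by
        rw [e, ← div_eq_mul_inv, div_div, div_le_div_iff₀ (by positivity) (by positivity)]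
        have h1 : t - m ≤ m / X := by
          have := ht.2
          rw [add_mul, one_mul, one_div_mul_eq_div] at this
          linarith
        have h2 : (t - m) * X ≤ t := by
          rw [le_div_iff₀ hX] at h1
          linarith [ht.1]
        calc x * (t - m) * (X * m) = (x * m) * ((t - m) * X) := by ring
          _ ≤ (x * m) * t := by gcongr
          _ = _ := by ring
      linarith
  rw [intervalIntegral.integral_const, smul_eq_mul] at hI
  refine (mul_le_mul_of_nonneg_left hI (by positivity)).trans (le_of_eq ?_)
  field_simp
  ring

lemma main_bound {x P X : ℝ} (hx : 3 ≤ x) (hP : 2 ≤ P) (hPx : P ≤ x) (hX : Real.log x ≤ X) :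
    ((roughSet x P).card : ℝ) + x / X * ∑ m ∈ roughSet x P, (m : ℝ)⁻¹
      ≤ (3 * (Real.log 4 + 5) + 3) * x / Real.log P := by
  have hl1 : 1 ≤ Real.log x := by
    rw [Real.le_log_iff_exp_le (by linarith)]
    linarith [Real.exp_one_lt_d9]
  have hlP : 0 < Real.log P := Real.log_pos (by linarith)
  have h4 : 0 < Real.log 4 := Real.log_pos (by norm_num)
  have hR : ∑ m ∈ roughSet x P, (m : ℝ)⁻¹ ≤ 3 * Real.log x / Real.log P := by
    rw [le_div_iff₀ hlP]
    refine (rough_recip (by linarith) hP).trans ?_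
    rw [Real.log_mul (by positivity) (by positivity)]
    have := Real.log_le_log (by linarith) hPx
    linarith
  have hc := rough_card (P := P) (show 1 ≤ x by linarith)
  have hc2 : ((roughSet x P).card : ℝ) ≤ 3 * (Real.log 4 + 5) * x / Real.log P := by
    have hlx : 0 < Real.log x := by linarith
    refine le_of_mul_le_mul_right ?_ hlx
    refine hc.trans ((mul_le_mul_of_nonneg_left hR (by positivity)).trans (le_of_eq ?_))
    ring
  have hs : x / X * ∑ m ∈ roughSet x P, (m : ℝ)⁻¹ ≤ 3 * x / Real.log P := by
    have hX0 : 0 < X := by linarith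
    refine (mul_le_mul_of_nonneg_left hR (by positivity)).trans ?_
    calc x / X * (3 * Real.log x / Real.log P)
        = (3 * x / Real.log P) * (Real.log x / X) := by ring
      _ ≤ (3 * x / Real.log P) * 1 := by
          gcongr
          exact (div_le_one hX0).2 hX
      _ = _ := by ring
  rw [add_mul, add_div]
  linarith

lemma exists_threshold : ∃ x0 : ℝ, ∀ x : ℝ, x0 ≤ x →
    Real.log x ≤ Real.exp ((Real.log x) ^ ((1 : ℝ) / 100)) := by
  have h : ∀ᶠ y : ℝ in Filter.atTop, y ≤ Real.exp (y ^ ((1 : ℝ) / 100)) := by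
    have h1 := (isLittleO_log_rpow_atTop (show (0 : ℝ) < 1 / 100 by norm_num)).bound
      (show (0 : ℝ) < 1 by norm_num)
    filter_upwards [h1, Filter.eventually_ge_atTop 1] with y hy hy1
    rw [one_mul, Real.norm_of_nonneg (Real.log_nonneg hy1),
      Real.norm_of_nonneg (by positivity)] at hy
    rwa [← Real.log_le_iff_le_exp (by linarith)]
  obtain ⟨x0, h0⟩ := Filter.eventually_atTop.1 (Real.tendsto_log_atTop.eventually h)
  exact ⟨x0, h0⟩

/-- the first applied sieve bound.  With `Q = exp((log x)^{1/3})` and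
`X = exp((log x)^{1/100})`, for any `2 ≤ P ≤ exp((log x)^{1/6})`,
`∑_{Q < m ≤ x, p ∣ m ⇒ p > P} (X/m) ∫_m^{(1+1/X)m} (x/m − x/t + 1) dt ≤ C x / log P`. -/
theorem applied_sieve_bound_one :
    ∃ C : ℝ, 0 < C ∧ ∃ x0 : ℝ, ∀ x : ℝ, x0 ≤ x →
      ∀ P : ℝ, 2 ≤ P → P ≤ Real.exp ((Real.log x) ^ ((1 : ℝ) / 6)) →
        (fun Q X =>
          ∑ m ∈ (Finset.Ioc ⌊Q⌋₊ ⌊x⌋₊).filter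
              (fun m => ∀ p : ℕ, p ∈ m.primeFactors → P < (p : ℝ)),
            (X / m) * ∫ t in (m : ℝ)..((1 + 1 / X) * m), (x / m - x / t + 1)
          ≤ C * x / Real.log P)
        (Real.exp ((Real.log x) ^ ((1 : ℝ) / 3)))
        (Real.exp ((Real.log x) ^ ((1 : ℝ) / 100))) := by
  have h4 : 0 < Real.log 4 := Real.log_pos (by norm_num)
  obtain ⟨x1, hx1⟩ := exists_threshold
  refine ⟨3 * (Real.log 4 + 5) + 3, by positivity, max x1 3, ?_⟩
  intro x hx P hP hPx
  have hx3 : 3 ≤ x := (le_max_right _ _).trans hx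
  have hX := hx1 x ((le_max_left _ _).trans hx)
  have hl1 : 1 ≤ Real.log x := by
    rw [Real.le_log_iff_exp_le (by linarith)]
    linarith [Real.exp_one_lt_d9]
  have hPx' : P ≤ x := by
    refine hPx.trans ?_
    rw [← Real.le_log_iff_exp_le (by linarith)]
    calc Real.log x ^ ((1 : ℝ) / 6) ≤ Real.log x ^ (1 : ℝ) :=
          Real.rpow_le_rpow_of_exponent_le hl1 (by norm_num)
      _ = _ := Real.rpow_one _
  refine le_trans ?_ (main_bound hx3 hP hPx' hX)
  set X := Real.exp ((Real.log x) ^ ((1 : ℝ) / 100)) with hXdef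
  have hX0 : 0 < X := Real.exp_pos _
  refine (Finset.sum_le_sum (g := fun m : ℕ => x / X * (m : ℝ)⁻¹ + 1) ?_).trans ?_
  · intro m hm
    rw [Finset.mem_filter, Finset.mem_Ioc] at hm
    exact term_bound (by linarith) hX0 (by omega)
  · refine (Finset.sum_le_sum_of_subset_of_nonneg (t := roughSet x P) ?_
      (fun m _ _ => by positivity)).trans (le_of_eq ?_)
    · intro m hm
      rw [Finset.mem_filter, Finset.mem_Ioc] at hm
      exact mem_roughSet.2 ⟨⟨by omega, hm.1.2⟩, hm.2⟩
    · rw [Finset.sum_add_distrib, ← Finset.mul_sum]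
      simp [add_comm]
end

section
/- There exist an absolute constant C and a threshold x0 such that the following holds for every real x ≥ x0. Set Q = exp((log x)^{1/3}) and X = exp((log x)^{1/100}), and let P be any real with 2 ≤ P ≤ exp((log x)^{1/6}). Then for every real t ≥ Q, Σ_{t/(1+1/X) < m ≤ t, every prime factor of m is > P} X/m ≤ C / log P. -/
open Finset

lemma bonf (A : Finset ℕ) (k : ℕ) :
    (if A = ∅ then (1:ℝ) else 0) ≤
      ∑ T ∈ A.powerset, (if T.card ≤ 2 * k then (-1 : ℝ) ^ T.card else 0) := by
  rw [Finset.sum_powerset_apply_card (fun j => if j ≤ 2 * k then (-1 : ℝ) ^ j else 0)]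
  have h : ∑ m ∈ range (A.card + 1), A.card.choose m • (if m ≤ 2 * k then (-1 : ℝ) ^ m else 0)
      = ∑ m ∈ range (2 * k + 1), (-1 : ℝ) ^ m * (A.card.choose m : ℝ) := by
    trans ∑ m ∈ range (A.card + 1 + (2 * k + 1)),
      A.card.choose m • (if m ≤ 2 * k then (-1 : ℝ) ^ m else 0)
    · apply Finset.sum_subset
      · intro i; simp only [mem_range]; omega
      · intro i _ hi
        simp only [mem_range] at hi
        rw [Nat.choose_eq_zero_of_lt (by omega)]; simp
    · symm
      trans ∑ m ∈ range (2 * k + 1),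
        A.card.choose m • (if m ≤ 2 * k then (-1 : ℝ) ^ m else 0)
      · apply Finset.sum_congr rfl
        intro i hi
        simp only [mem_range] at hi
        rw [if_pos (by omega)]; simp [mul_comm]
      · apply Finset.sum_subset
        · intro i; simp only [mem_range]; omega
        · intro i _ hi
          simp only [mem_range] at hi
          rw [if_neg (by omega)]; simp
  rw [h]
  by_cases hA : A = ∅
  · subst hA
    rw [Finset.sum_range_succ']
    simp
  · rw [if_neg hA]
    obtain ⟨n, hn⟩ := Nat.exists_eq_succ_of_ne_zero (Finset.card_ne_zero.mpr (Finset.nonempty_iff_ne_empty.mpr hA))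
    have := @Int.alternating_sum_range_choose_eq_choose n (2 * k)
    have h2 : ∑ m ∈ range (2 * k + 1), (-1 : ℝ) ^ m * (A.card.choose m : ℝ) = (-1)^(2*k) * (n.choose (2*k) : ℝ) := by
      rw [hn]; exact_mod_cast this
    rw [h2, pow_mul]; simp

lemma count_mult (a b d : ℕ) (hab : a ≤ b) (hd : 0 < d) :
    |(((Ioc a b).filter (fun m => d ∣ m)).card : ℝ) - ((b : ℝ) - a) / d| ≤ 1 := by
  have h1 : ((Ioc 0 a).filter (fun m => d ∣ m)).card + ((Ioc a b).filter (fun m => d ∣ m)).card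
      = ((Ioc 0 b).filter (fun m => d ∣ m)).card := by
    rw [← Finset.Ioc_union_Ioc_eq_Ioc (Nat.zero_le a) hab, Finset.filter_union,
      Finset.card_union_of_disjoint]
    apply Finset.disjoint_filter_filter
    exact Finset.Ioc_disjoint_Ioc_of_le le_rfl
  rw [Nat.Ioc_filter_dvd_card_eq_div, Nat.Ioc_filter_dvd_card_eq_div] at h1
  have h2 : ((a / d : ℕ) : ℝ) + ((((Ioc a b).filter (fun m => d ∣ m)).card : ℕ) : ℝ) = ((b / d : ℕ) : ℝ) := by
    exact_mod_cast h1
  have e1 : ∀ n : ℕ, ((n / d : ℕ) : ℝ) ≤ (n : ℝ) / d := fun n => Nat.cast_div_le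
  have e2 : ∀ n : ℕ, (n : ℝ) / d ≤ ((n / d : ℕ) : ℝ) + 1 := by
    intro n
    rw [div_le_iff₀ (by exact_mod_cast hd)]
    have := Nat.lt_div_mul_add (a := n) hd
    have h : n ≤ (n / d + 1) * d := by linarith
    exact_mod_cast h
  rw [sub_div, abs_le]
  constructor <;> linarith [e1 a, e1 b, e2 a, e2 b]

lemma sieve (a b k : ℕ) (hab : a ≤ b) (S : Finset ℕ) (hS : ∀ p ∈ S, p.Prime) :
    (((Ioc a b).filter (fun m => ∀ p ∈ S, ¬ p ∣ m)).card : ℝ) ≤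
      ((b : ℝ) - a) * (∏ p ∈ S, (1 - (p : ℝ)⁻¹) +
        ∑ T ∈ S.powerset, (if T.card ≤ 2 * k then 0 else ∏ p ∈ T, (p : ℝ)⁻¹)) +
      ∑ T ∈ S.powerset, (if T.card ≤ 2 * k then 1 else 0) := by
  have hcop : ∀ T ∈ S.powerset, ∀ m : ℕ, (∏ p ∈ T, p) ∣ m ↔ ∀ p ∈ T, p ∣ m := by
    intro T hT m
    constructor
    · intro h p hp
      exact (Finset.dvd_prod_of_mem _ hp).trans h
    · intro h
      apply Finset.prod_primes_dvd m _ h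
      intro p hp
      exact (hS p (Finset.mem_powerset.mp hT hp)).prime
  have step1 : (((Ioc a b).filter (fun m => ∀ p ∈ S, ¬ p ∣ m)).card : ℝ) ≤
      ∑ m ∈ Ioc a b, ∑ T ∈ S.powerset,
        (if T.card ≤ 2 * k then (-1 : ℝ) ^ T.card else 0) * (if (∏ p ∈ T, p) ∣ m then 1 else 0) := by
    rw [Finset.card_filter]
    push_cast
    apply Finset.sum_le_sum
    intro m _
    have hb := bonf (S.filter (fun p => p ∣ m)) k
    simp only [Finset.filter_eq_empty_iff] at hb
    refine hb.trans (le_of_eq ?_)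
    have : (S.filter (fun p => p ∣ m)).powerset = S.powerset.filter (fun T => (∏ p ∈ T, p) ∣ m) := by
      ext T
      simp only [Finset.mem_powerset, Finset.mem_filter]
      constructor
      · intro h
        have h1 : T ⊆ S := fun p hp => (Finset.mem_filter.mp (h hp)).1
        exact ⟨h1, (hcop T (Finset.mem_powerset.mpr h1) m).mpr
          fun p hp => (Finset.mem_filter.mp (h hp)).2⟩
      · rintro ⟨h1, h2⟩ p hp
        exact Finset.mem_filter.mpr ⟨h1 hp, (hcop T (Finset.mem_powerset.mpr h1) m).mp h2 p hp⟩
    rw [this, Finset.sum_filter]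
    apply Finset.sum_congr rfl
    intro T _
    split_ifs <;> simp
  refine step1.trans ?_
  rw [Finset.sum_comm]
  have hprod : ∏ p ∈ S, (1 - (p : ℝ)⁻¹) = ∑ T ∈ S.powerset, (-1 : ℝ) ^ T.card * ∏ p ∈ T, (p : ℝ)⁻¹ := by
    simp_rw [sub_eq_add_neg]
    rw [Finset.prod_one_add]
    apply Finset.sum_congr rfl
    intro T _
    rw [Finset.prod_neg]
  rw [hprod, ← Finset.sum_add_distrib, Finset.mul_sum, ← Finset.sum_add_distrib]
  apply Finset.sum_le_sum
  intro T hT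
  rw [← Finset.mul_sum]
  have hc : ∑ m ∈ Ioc a b, (if (∏ p ∈ T, p) ∣ m then (1:ℝ) else 0) =
      (((Ioc a b).filter (fun m => (∏ p ∈ T, p) ∣ m)).card : ℝ) := by
    rw [Finset.card_filter]; push_cast; rfl
  rw [hc]
  have hpos : 0 < ∏ p ∈ T, p :=
    Finset.prod_pos fun p hp => (hS p (Finset.mem_powerset.mp hT hp)).pos
  have hcm := count_mult a b (∏ p ∈ T, p) hab hpos
  have hinv : ∏ p ∈ T, (p : ℝ)⁻¹ = (((∏ p ∈ T, p : ℕ)) : ℝ)⁻¹ := by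
    rw [Finset.prod_inv_distrib]; push_cast; rfl
  rw [hinv]
  rw [div_eq_mul_inv] at hcm
  have hab' : (a : ℝ) ≤ b := by exact_mod_cast hab
  have hi : 0 ≤ (((∏ p ∈ T, p : ℕ)) : ℝ)⁻¹ := by positivity
  generalize (((∏ p ∈ T, p : ℕ)) : ℝ)⁻¹ = v at *
  generalize (((Ioc a b).filter (fun m => (∏ p ∈ T, p) ∣ m)).card : ℝ) = w at *
  rw [abs_le] at hcm
  have hv : 0 ≤ ((b : ℝ) - a) * v := mul_nonneg (by linarith) hi
  rcases neg_one_pow_eq_or ℝ T.card with h | h <;> rw [h] <;> split_ifs <;> nlinarith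

lemma tail_bound (S : Finset ℕ) (k : ℕ) :
    ∑ T ∈ S.powerset, (if T.card ≤ 2 * k then 0 else ∏ p ∈ T, (p : ℝ)⁻¹) ≤
      Real.exp (-(2 * k)) * Real.exp (3 * ∑ p ∈ S, (p : ℝ)⁻¹) := by
  have h1 : ∏ p ∈ S, (1 + Real.exp 1 * (p : ℝ)⁻¹) ≤ Real.exp (3 * ∑ p ∈ S, (p : ℝ)⁻¹) := by
    rw [Finset.mul_sum, Real.exp_sum]
    apply Finset.prod_le_prod
    · intros; positivity
    · intro p _
      have : Real.exp 1 * (p : ℝ)⁻¹ ≤ 3 * (p : ℝ)⁻¹ := by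
        gcongr; linarith [Real.exp_one_lt_d9]
      linarith [Real.add_one_le_exp (3 * (p : ℝ)⁻¹)]
  refine le_trans ?_ (mul_le_mul_of_nonneg_left h1 (Real.exp_pos _).le)
  rw [Finset.prod_one_add, Finset.mul_sum]
  apply Finset.sum_le_sum
  intro T _
  rw [Finset.prod_mul_distrib, Finset.prod_const, ← Real.exp_nat_mul, ← mul_assoc, ← Real.exp_add]
  have hp : 0 ≤ ∏ p ∈ T, (p : ℝ)⁻¹ := Finset.prod_nonneg fun _ _ => by positivity
  split_ifs with h
  · positivity
  · refine le_mul_of_one_le_left hp (Real.one_le_exp ?_)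
    have : ((2 * k : ℕ) : ℝ) ≤ T.card := by exact_mod_cast (by omega : 2 * k ≤ T.card)
    push_cast at this
    linarith

lemma card_bound (S : Finset ℕ) (k N : ℕ) (hN : 1 ≤ N) (hS : S.card ≤ N) :
    ∑ T ∈ S.powerset, (if T.card ≤ 2 * k then (1 : ℝ) else 0) ≤
      (N : ℝ) ^ (2 * k) * Real.exp 1 := by
  have hN' : (1 : ℝ) ≤ N := by exact_mod_cast hN
  have h1 : ∏ p ∈ S, (1 + (N : ℝ)⁻¹) ≤ Real.exp 1 := by
    calc ∏ p ∈ S, (1 + (N : ℝ)⁻¹) ≤ ∏ p ∈ S, Real.exp ((N : ℝ)⁻¹) := by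
          apply Finset.prod_le_prod
          · intros; positivity
          · intro p _; linarith [Real.add_one_le_exp ((N : ℝ)⁻¹)]
      _ = Real.exp (S.card * (N : ℝ)⁻¹) := by rw [Finset.prod_const, Real.exp_nat_mul]
      _ ≤ Real.exp 1 := by
          apply Real.exp_le_exp.mpr
          rw [← div_eq_mul_inv, div_le_one (by linarith)]
          exact_mod_cast hS
  refine le_trans ?_ (mul_le_mul_of_nonneg_left h1 (by positivity))
  rw [Finset.prod_one_add, Finset.mul_sum]
  apply Finset.sum_le_sum
  intro T _
  rw [Finset.prod_const]
  split_ifs with h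
  · rw [inv_pow, ← div_eq_mul_inv, one_le_div (by positivity)]
    exact pow_le_pow_right₀ hN' h
  · positivity

lemma sum_recip (N : ℕ) : ∑ p ∈ (N + 1).primesBelow, (p : ℝ)⁻¹ ≤ 1 + Real.log N := by
  refine le_trans ?_ (harmonic_le_one_add_log N)
  rw [harmonic_eq_sum_Icc]
  push_cast
  apply Finset.sum_le_sum_of_subset_of_nonneg
  · intro p hp
    rw [Nat.mem_primesBelow] at hp
    exact Finset.mem_Icc.mpr ⟨hp.2.one_le, by omega⟩
  · intros; positivity

lemma card_primesBelow_le (N : ℕ) : ((N + 1).primesBelow).card ≤ N := by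
  have : (N + 1).primesBelow ⊆ Finset.Icc 1 N := by
    intro p hp
    rw [Nat.mem_primesBelow] at hp
    exact Finset.mem_Icc.mpr ⟨hp.2.one_le, by omega⟩
  simpa using Finset.card_le_card this

lemma mertens (N : ℕ) :
    Real.log (N + 1) * ∏ p ∈ (N + 1).primesBelow, (1 - (p : ℝ)⁻¹) ≤ 1 := by
  let f : ℕ →* ℝ := ⟨⟨fun n => (n : ℝ)⁻¹, by simp⟩, by intro x y; simp [mul_comm]⟩
  have hf : ∀ n, f n = (n : ℝ)⁻¹ := fun n => rfl
  obtain ⟨-, hs⟩ := EulerProduct.summable_and_hasSum_smoothNumbers_prod_primesBelow_geometric (f := f)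
    (by
      intro p hp
      rw [hf, norm_inv, Real.norm_natCast]
      exact inv_lt_one_of_one_lt₀ (by exact_mod_cast hp.one_lt)) (N + 1)
  have hsm : ∀ n ∈ Finset.Icc 1 N, n ∈ (N + 1).smoothNumbers := by
    intro n hn
    rw [Finset.mem_Icc] at hn
    rw [Nat.mem_smoothNumbers']
    intro p _ hpn
    have := Nat.le_of_dvd (by omega) hpn
    omega
  have h1 : (harmonic N : ℝ) ≤ ∏ p ∈ (N + 1).primesBelow, (1 - f p)⁻¹ := by
    have := sum_le_hasSum ((Finset.Icc 1 N).subtype (fun n => n ∈ (N + 1).smoothNumbers))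
      (fun i _ => by rw [hf]; positivity) hs
    refine le_trans (le_of_eq ?_) this
    rw [harmonic_eq_sum_Icc]
    push_cast
    rw [Finset.sum_subtype_of_mem (fun n => f n) hsm]
    rfl
  have h2 := log_add_one_le_harmonic N
  push_cast at h2
  have hpos : 0 < ∏ p ∈ (N + 1).primesBelow, (1 - (p : ℝ)⁻¹) := by
    apply Finset.prod_pos
    intro p hp
    have : (1:ℝ) < p := by exact_mod_cast (Nat.prime_of_mem_primesBelow hp).one_lt
    linarith [inv_lt_one_of_one_lt₀ this]
  rw [Finset.prod_inv_distrib] at h1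
  simp only [hf] at h1
  have := h2.trans h1
  rwa [← one_div, le_div_iff₀ hpos] at this

/-- Combined sieve bound with everything explicit. -/
lemma combined (L P : ℝ) (hL : 10 ≤ L) (hP : 2 ≤ P) (hPL : Real.log P ≤ L) (a b : ℕ) (hab : a ≤ b) :
    (((Ioc a b).filter (fun m => ∀ p : ℕ, p ∈ m.primeFactors → P < (p : ℝ))).card : ℝ) ≤
      ((b : ℝ) - a) * (4 / Real.log P + Real.exp 3 / Real.log P)
        + Real.exp (L ^ 2 / 2 + L / 2 + 1) := by
  have hlogP : 0 < Real.log P := Real.log_pos (by linarith)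
  set y : ℝ := Real.exp (Real.log P / 4) with hy
  set N : ℕ := ⌊y⌋₊ with hN
  have hy1 : 1 ≤ y := Real.one_le_exp (by linarith)
  have hN1 : 1 ≤ N := Nat.le_floor (by simpa using hy1)
  have hNy : (N : ℝ) ≤ y := Nat.floor_le (by linarith)
  have hyP : y ≤ P := by
    rw [← Real.exp_log (show 0 < P by linarith), hy]
    apply Real.exp_le_exp.mpr
    linarith
  have hlogN : Real.log N ≤ Real.log P / 4 := by
    rw [Real.log_le_iff_le_exp (by exact_mod_cast hN1)]; exact hNy
  have hlogN1 : Real.log P / 4 ≤ Real.log (N + 1) := by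
    rw [Real.le_log_iff_exp_le (by positivity)]; exact (Nat.lt_floor_add_one y).le
  set k : ℕ := ⌈L⌉₊ with hk
  have hkL : L ≤ k := Nat.le_ceil L
  have hkL' : (k : ℝ) ≤ L + 1 := (Nat.ceil_lt_add_one (by linarith)).le
  obtain ⟨S, hSdef⟩ : ∃ S, S = (N + 1).primesBelow := ⟨_, rfl⟩
  have hsub : (((Ioc a b).filter (fun m => ∀ p : ℕ, p ∈ m.primeFactors → P < (p : ℝ))).card : ℝ) ≤
      (((Ioc a b).filter (fun m => ∀ p ∈ S, ¬ p ∣ m)).card : ℝ) := by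
    norm_cast
    apply Finset.card_le_card
    intro m hm
    rw [Finset.mem_filter] at hm ⊢
    refine ⟨hm.1, fun p hp hpm => ?_⟩
    rw [hSdef, Nat.mem_primesBelow] at hp
    have hm0 : m ≠ 0 := by have := Finset.mem_Ioc.mp hm.1; omega
    have h1 := hm.2 p (Nat.mem_primeFactors.mpr ⟨hp.2, hpm, hm0⟩)
    have h2 : (p : ℝ) ≤ N := by exact_mod_cast (by omega : p ≤ N)
    linarith
  have hab' : (0 : ℝ) ≤ (b : ℝ) - a := by
    have : (a : ℝ) ≤ b := by exact_mod_cast hab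
    linarith
  refine hsub.trans ((sieve a b k hab S (fun p hp => Nat.prime_of_mem_primesBelow (hSdef ▸ hp))).trans ?_)
  rw [hSdef]
  have hprod : ∏ p ∈ (N + 1).primesBelow, (1 - (p : ℝ)⁻¹) ≤ 4 / Real.log P := by
    have hpos : 0 ≤ ∏ p ∈ (N + 1).primesBelow, (1 - (p : ℝ)⁻¹) := by
      apply Finset.prod_nonneg
      intro p hp
      have : (1:ℝ) ≤ p := by exact_mod_cast (Nat.prime_of_mem_primesBelow hp).one_le
      linarith [inv_le_one_of_one_le₀ this]
    rw [le_div_iff₀ hlogP]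
    have := mertens N
    nlinarith
  have htail : ∑ T ∈ (N + 1).primesBelow.powerset,
      (if T.card ≤ 2 * k then 0 else ∏ p ∈ T, (p : ℝ)⁻¹) ≤ Real.exp 3 / Real.log P := by
    refine (tail_bound _ k).trans ?_
    have h1 := sum_recip N
    rw [← Real.exp_add]
    calc Real.exp _ ≤ Real.exp (3 + -Real.log P) := by
          apply Real.exp_le_exp.mpr; linarith
      _ = Real.exp 3 / Real.exp (Real.log P) := by rw [Real.exp_add, Real.exp_neg]; rfl
      _ ≤ _ := by
          gcongr
          linarith [Real.add_one_le_exp (Real.log P)]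
  have hcard : ∑ T ∈ (N + 1).primesBelow.powerset, (if T.card ≤ 2 * k then (1 : ℝ) else 0) ≤
      Real.exp (L ^ 2 / 2 + L / 2 + 1) := by
    refine (card_bound _ k N hN1 (card_primesBelow_le N)).trans ?_
    rw [Real.exp_add]
    gcongr
    calc (N : ℝ) ^ (2 * k) ≤ y ^ (2 * k) := by gcongr
      _ = Real.exp ((2 * k : ℕ) * (Real.log P / 4)) := by rw [hy, Real.exp_nat_mul]
      _ ≤ _ := by
          apply Real.exp_le_exp.mpr
          push_cast
          nlinarith
  gcongr

/-- the second applied sieve bound.  With `Q = exp((log x)^{1/3})` and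
`X = exp((log x)^{1/100})`, for any `2 ≤ P ≤ exp((log x)^{1/6})` and any `t ≥ Q`,
`∑_{t/(1+1/X) < m ≤ t, p ∣ m ⇒ p > P} X/m ≤ C / log P`. -/
theorem applied_sieve_bound_two :
    ∃ C : ℝ, 0 < C ∧ ∃ x0 : ℝ, ∀ x : ℝ, x0 ≤ x →
      ∀ P : ℝ, 2 ≤ P → P ≤ Real.exp ((Real.log x) ^ ((1 : ℝ) / 6)) →
        (fun Q X =>
          ∀ t : ℝ, Q ≤ t →
            ∑ m ∈ (Finset.Ioc ⌊t / (1 + 1 / X)⌋₊ ⌊t⌋₊).filter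
                (fun m => ∀ p : ℕ, p ∈ m.primeFactors → P < (p : ℝ)),
              X / m
            ≤ C / Real.log P)
        (Real.exp ((Real.log x) ^ ((1 : ℝ) / 3)))
        (Real.exp ((Real.log x) ^ ((1 : ℝ) / 100))) := by
  refine ⟨4 * (4 + Real.exp 3) + 2, by positivity, Real.exp (10 ^ 6), ?_⟩
  intro x hx P hP hPx t ht
  have hl : (10 : ℝ) ^ 6 ≤ Real.log x := by
    rw [Real.le_log_iff_exp_le (lt_of_lt_of_le (Real.exp_pos _) hx)]; exact hx
  have hl1 : (1 : ℝ) ≤ Real.log x := by linarith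
  set L : ℝ := (Real.log x) ^ ((1 : ℝ) / 6) with hLdef
  have hL : 10 ≤ L := by
    calc (10 : ℝ) = ((10 : ℝ) ^ 6) ^ ((1 : ℝ) / 6) := by
          rw [← Real.rpow_natCast, ← Real.rpow_mul (by norm_num)]; norm_num
      _ ≤ L := by rw [hLdef]; gcongr
  have hL2 : (Real.log x) ^ ((1 : ℝ) / 3) = L ^ 2 := by
    rw [hLdef, ← Real.rpow_natCast, ← Real.rpow_mul (by linarith)]; norm_num
  have hXL : (Real.log x) ^ ((1 : ℝ) / 100) ≤ L :=
    Real.rpow_le_rpow_of_exponent_le hl1 (by norm_num)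
  have hX0 : 0 ≤ (Real.log x) ^ ((1 : ℝ) / 100) := by positivity
  rw [hL2] at ht
  set X : ℝ := Real.exp ((Real.log x) ^ ((1 : ℝ) / 100)) with hX
  have hX1 : 1 ≤ X := Real.one_le_exp hX0
  have hXpos : 0 < X := by linarith
  have hXle : X ≤ Real.exp L := Real.exp_le_exp.mpr hXL
  have hlogP : 0 < Real.log P := Real.log_pos (by linarith)
  have hPL : Real.log P ≤ L := by
    rwa [Real.log_le_iff_le_exp (by linarith)]
  have htpos : 0 < t := lt_of_lt_of_le (Real.exp_pos _) ht
  have htX : X ≤ t := by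
    refine hXle.trans (le_trans (Real.exp_le_exp.mpr ?_) ht); nlinarith
  set u : ℝ := t / (1 + 1 / X) with hu
  have hut : u ≤ t := by
    apply div_le_self htpos.le
    have : 0 < 1 / X := by positivity
    linarith
  have hu0 : 0 ≤ u := by positivity
  have hu2 : t / 2 ≤ u := by
    rw [hu]
    apply div_le_div_of_nonneg_left htpos.le (by positivity)
    have : 1 / X ≤ 1 := by rw [div_le_one hXpos]; exact hX1
    linarith
  have hutX : t - u ≤ t / X := by
    have h1 : t = u * (1 + 1 / X) := by rw [hu]; field_simp
    have h2 : t - u = u / X := by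
      have : u * (1 + 1 / X) = u + u / X := by ring
      linarith
    rw [h2]; gcongr
  have hfl : ⌊u⌋₊ ≤ ⌊t⌋₊ := Nat.floor_mono hut
  have hH : ((⌊t⌋₊ : ℝ) - ⌊u⌋₊) ≤ 2 * (t / X) := by
    have h1 := Nat.floor_le htpos.le
    have h2 := Nat.lt_floor_add_one u
    have h3 : 1 ≤ t / X := by rw [one_le_div hXpos]; exact htX
    linarith
  have hcomb := combined L P hL hP hPL ⌊u⌋₊ ⌊t⌋₊ hfl
  set F := (Finset.Ioc ⌊u⌋₊ ⌊t⌋₊).filter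
    (fun m => ∀ p : ℕ, p ∈ m.primeFactors → P < (p : ℝ)) with hF
  have hsum : ∑ m ∈ F, X / (m : ℝ) ≤ F.card * (2 * (X / t)) := by
    rw [← nsmul_eq_mul]
    apply Finset.sum_le_card_nsmul
    intro m hm
    have h1 : u < m := by
      rw [← Nat.floor_lt hu0]
      exact (Finset.mem_Ioc.mp (Finset.mem_filter.mp hm).1).1
    have : 2 * (X / t) = X / (t / 2) := by field_simp
    rw [this]
    apply div_le_div_of_nonneg_left hXpos.le (by positivity)
    linarith
  have hE : Real.exp (L ^ 2 / 2 + L / 2 + 1) * (X / t) ≤ 1 / Real.log P := by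
    rw [le_div_iff₀ hlogP]
    have hLe : Real.log P ≤ Real.exp L := by linarith [Real.add_one_le_exp L]
    have hXt : X / t ≤ Real.exp (L - L ^ 2) := by
      rw [Real.exp_sub]; gcongr
    calc _ ≤ Real.exp (L ^ 2 / 2 + L / 2 + 1) * Real.exp (L - L ^ 2) * Real.exp L := by gcongr
      _ = Real.exp (L ^ 2 / 2 + L / 2 + 1 + (L - L ^ 2) + L) := by
          rw [Real.exp_add (_ + (L - L ^ 2)), Real.exp_add _ (L - L ^ 2)]
      _ ≤ 1 := by
          rw [Real.exp_le_one_iff]; nlinarith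
  have hcard : (F.card : ℝ) ≤ 2 * (t / X) * (4 / Real.log P + Real.exp 3 / Real.log P)
        + Real.exp (L ^ 2 / 2 + L / 2 + 1) := by
    refine hcomb.trans ?_
    gcongr
  calc ∑ m ∈ F, X / (m : ℝ) ≤ F.card * (2 * (X / t)) := hsum
    _ ≤ (2 * (t / X) * (4 / Real.log P + Real.exp 3 / Real.log P)
        + Real.exp (L ^ 2 / 2 + L / 2 + 1)) * (2 * (X / t)) := by gcongr
    _ = 4 * (4 / Real.log P + Real.exp 3 / Real.log P)
        + 2 * (Real.exp (L ^ 2 / 2 + L / 2 + 1) * (X / t)) := by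
        field_simp; ring
    _ ≤ 4 * (4 / Real.log P + Real.exp 3 / Real.log P) + 2 * (1 / Real.log P) := by gcongr
    _ = _ := by field_simp
end

section
/- There exist N0 ∈ ℕ and δ0 > 0 such that for every integer N ≥ N0 and every real δ ∈ (0, δ0] there exist functions g: ℝ → ℝ and g_{N+1}: ℝ → ℝ with the following properties, where g_j(x) := g(x − j) for integers j with |j| ≤ N: (i) Σ_{|j| ≤ N} g_j(x) + g_{N+1}(x) = 1 for all x ∈ ℝ; (ii) g(x) ≥ 0 for all x ∈ ℝ, and g(x) ≤ δ whenever |x| > 1; (iii) g_{N+1}(x) ≥ 0 for all x ∈ ℝ, and g_{N+1}(x) ≤ δ whenever |x| ≤ N; (iv) g is infinitely differentiable and for every integer ℓ ≥ 1 and all x ∈ ℝ, |g^{(ℓ)}(x)| ≤ (1/(π(ℓ+1))) · (2π/δ)^{ℓ+1}. -/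
/-- The integrals `∫₀¹ (1-t) t^m cos(tx + mπ/2) dt`, the derivatives of the Fejer kernel. -/
noncomputable def fejF (m : ℕ) (x : ℝ) : ℝ :=
  ∫ t in (0:ℝ)..1, (1 - t) * t ^ m * Real.cos (t * x + m * (Real.pi / 2))

theorem fejF_hasDerivAt (m : ℕ) (x : ℝ) : HasDerivAt (fejF m) (fejF (m + 1) x) x := by
  have key := intervalIntegral.hasDerivAt_integral_of_dominated_loc_of_deriv_le
    (μ := MeasureTheory.volume) (a := (0:ℝ)) (b := 1) (x₀ := x) (s := Set.univ)
    (F := fun x t => (1 - t) * t ^ m * Real.cos (t * x + m * (Real.pi / 2)))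
    (F' := fun x t => (1 - t) * t ^ (m + 1) * Real.cos (t * x + (m + 1 : ℕ) * (Real.pi / 2)))
    (bound := fun _ => 1) Filter.univ_mem
    (Filter.Eventually.of_forall fun y => by
      apply Continuous.aestronglyMeasurable; fun_prop)
    (by apply Continuous.intervalIntegrable; fun_prop)
    (by apply Continuous.aestronglyMeasurable; fun_prop)
    (Filter.Eventually.of_forall fun t ht y _ => by
      rw [Set.uIoc_of_le zero_le_one] at ht
      rw [norm_mul, norm_mul, Real.norm_eq_abs, Real.norm_eq_abs, Real.norm_eq_abs]
      have h1 : |1 - t| ≤ 1 := by rw [abs_le]; constructor <;> linarith [ht.1, ht.2]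
      have h2 : |t ^ (m + 1)| ≤ 1 := by
        rw [abs_of_nonneg (pow_nonneg ht.1.le _)]
        exact pow_le_one₀ ht.1.le ht.2
      have h3 := Real.abs_cos_le_one (t * y + (m + 1 : ℕ) * (Real.pi / 2))
      exact mul_le_one₀ (mul_le_one₀ h1 (abs_nonneg _) h2) (abs_nonneg _) h3)
    (by simp)
    (Filter.Eventually.of_forall fun t _ y _ => by
      have e : Real.cos (t * y + (m + 1 : ℕ) * (Real.pi / 2))
          = - Real.sin (t * y + m * (Real.pi / 2)) := by
        rw [← Real.cos_add_pi_div_two]; congr 1; push_cast; ring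
      have h : HasDerivAt (fun y : ℝ => t * y + m * (Real.pi / 2)) t y := by
        simpa using ((hasDerivAt_id y).const_mul t).add_const (m * (Real.pi / 2))
      have := (h.cos).const_mul ((1 - t) * t ^ m)
      refine this.congr_deriv ?_
      simp only [e]; ring)
  exact key.2

theorem fejF_continuous (m : ℕ) : Continuous (fejF m) :=
  continuous_iff_continuousAt.2 fun x => (fejF_hasDerivAt m x).continuousAt

theorem fejF_abs_le (m : ℕ) (x : ℝ) : |fejF m x| ≤ 1 / ((m + 1) * (m + 2)) := by
  have h := intervalIntegral.norm_integral_le_of_norm_le (μ := MeasureTheory.volume)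
    (a := (0:ℝ)) (b := 1)
    (f := fun t => (1 - t) * t ^ m * Real.cos (t * x + m * (Real.pi / 2)))
    (g := fun t => t ^ m - t ^ (m + 1)) zero_le_one
    (Filter.Eventually.of_forall fun t ht => by
      rw [norm_mul, Real.norm_eq_abs, Real.norm_eq_abs]
      have h0 : 0 ≤ (1 - t) * t ^ m :=
        mul_nonneg (by linarith [ht.2]) (pow_nonneg ht.1.le _)
      rw [abs_of_nonneg h0]
      calc _ ≤ (1 - t) * t ^ m * 1 :=
            mul_le_mul_of_nonneg_left (Real.abs_cos_le_one _) h0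
        _ = _ := by ring)
    (by apply Continuous.intervalIntegrable; fun_prop)
  rw [intervalIntegral.integral_sub (by apply Continuous.intervalIntegrable; fun_prop)
    (by apply Continuous.intervalIntegrable; fun_prop), integral_pow, integral_pow] at h
  refine h.trans (le_of_eq ?_)
  push_cast
  have : (m:ℝ) + 1 ≠ 0 := by positivity
  have : (m:ℝ) + 2 ≠ 0 := by positivity
  have : (m:ℝ) + 1 + 1 ≠ 0 := by positivity
  simp
  field_simp
  ring

theorem fejF_zero_formula {u : ℝ} (hu : u ≠ 0) : fejF 0 u = (1 - Real.cos u) / u ^ 2 := by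
  have h := intervalIntegral.integral_eq_sub_of_hasDerivAt (a := (0:ℝ)) (b := 1)
    (f := fun t => (1 - t) * Real.sin (t * u) / u - Real.cos (t * u) / u ^ 2)
    (f' := fun t => (1 - t) * t ^ 0 * Real.cos (t * u + (0:ℕ) * (Real.pi / 2)))
    (fun t _ => by
      have h : HasDerivAt (fun t : ℝ => t * u) u t := by
        simpa using (hasDerivAt_id t).mul_const u
      have h1 : HasDerivAt (fun t : ℝ => 1 - t) (-1) t := by
        simpa using (hasDerivAt_id t).const_sub 1
      refine (((h1.mul h.sin).div_const u).sub (h.cos.div_const (u ^ 2))).congr_deriv ?_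
      simp
      field_simp
      ring)
    (by apply Continuous.intervalIntegrable; fun_prop)
  unfold fejF
  rw [h]
  simp
  field_simp
  ring

theorem fejF_zero_nonneg (u : ℝ) : 0 ≤ fejF 0 u := by
  by_cases hu : u = 0
  · subst hu
    unfold fejF
    apply intervalIntegral.integral_nonneg zero_le_one
    intro t ht
    simp [ht.2]
  · rw [fejF_zero_formula hu]
    exact div_nonneg (by linarith [Real.cos_le_one u]) (sq_nonneg _)

theorem fejF_zero_even (u : ℝ) : fejF 0 (-u) = fejF 0 u := by
  simp [fejF]

/-- Primitive of the Fejer kernel. -/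
noncomputable def fejG (x : ℝ) : ℝ := ∫ u in (0:ℝ)..x, fejF 0 u

theorem fejG_hasDerivAt (x : ℝ) : HasDerivAt fejG (fejF 0 x) x :=
  intervalIntegral.integral_hasDerivAt_right ((fejF_continuous 0).intervalIntegrable _ _)
    ((fejF_continuous 0).stronglyMeasurableAtFilter _ _) (fejF_continuous 0).continuousAt

theorem fejG_mono : Monotone fejG :=
  monotone_of_deriv_nonneg (fun x => (fejG_hasDerivAt x).differentiableAt)
    (fun x => by rw [(fejG_hasDerivAt x).deriv]; exact fejF_zero_nonneg x)

theorem fejG_zero : fejG 0 = 0 := by simp [fejG]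

theorem fejG_odd (x : ℝ) : fejG (-x) = - fejG x := by
  unfold fejG
  have := intervalIntegral.integral_comp_neg (a := 0) (b := x) (f := fejF 0)
  simp only [fejF_zero_even, neg_zero] at this
  rw [this, intervalIntegral.integral_symm]

theorem fejG_tail {z y : ℝ} (hz : 0 < z) (hzy : z ≤ y) : fejG y ≤ fejG z + 2 / z := by
  have hd : ∀ x : ℝ, 0 < x → HasDerivAt (fun x => fejG x + 2 * x⁻¹)
      (fejF 0 x + 2 * (-(x ^ 2)⁻¹)) x := fun x hx =>
    (fejG_hasDerivAt x).add ((hasDerivAt_inv hx.ne').const_mul 2)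
  have h : AntitoneOn (fun x => fejG x + 2 * x⁻¹) (Set.Ioi 0) := by
    apply antitoneOn_of_deriv_nonpos (convex_Ioi 0)
    · exact fun x hx => (hd x hx).continuousAt.continuousWithinAt
    · intro x hx
      rw [interior_Ioi] at hx
      exact (hd x hx).differentiableAt.differentiableWithinAt
    · intro x hx
      rw [interior_Ioi] at hx
      have hx' : 0 < x := hx
      rw [(hd x hx).deriv, fejF_zero_formula hx'.ne', div_eq_mul_inv]
      have : 0 < (x ^ 2)⁻¹ := by positivity
      nlinarith [Real.neg_one_le_cos x]
  have h2 := h (Set.mem_Ioi.2 hz) (Set.mem_Ioi.2 (hz.trans_le hzy)) hzy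
  have h3 : 0 < 2 * y⁻¹ := by have := hz.trans_le hzy; positivity
  simp only at h2
  rw [div_eq_mul_inv]
  linarith

theorem fejG_pi : 2 / Real.pi ≤ fejG Real.pi := by
  have hd : ∀ x : ℝ, HasDerivAt (fun x => fejG x - 2 / Real.pi ^ 2 * x)
      (fejF 0 x - 2 / Real.pi ^ 2 * 1) x := fun x =>
    (fejG_hasDerivAt x).sub ((hasDerivAt_id x).const_mul _)
  have h : MonotoneOn (fun x => fejG x - 2 / Real.pi ^ 2 * x) (Set.Icc 0 Real.pi) := by
    apply monotoneOn_of_deriv_nonneg (convex_Icc _ _)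
    · exact fun x hx => (hd x).continuousAt.continuousWithinAt
    · exact fun x hx => (hd x).differentiableAt.differentiableWithinAt
    · intro x hx
      rw [interior_Icc] at hx
      rw [(hd x).deriv, fejF_zero_formula hx.1.ne']
      have h1 := Real.cos_le_one_sub_mul_cos_sq (x := x) (by rw [abs_of_pos hx.1]; exact hx.2.le)
      rw [sub_nonneg, mul_one, le_div_iff₀ (pow_pos hx.1 2)]
      linarith
  have h2 := h (Set.left_mem_Icc.2 Real.pi_pos.le) (Set.right_mem_Icc.2 Real.pi_pos.le)
    Real.pi_pos.le
  simp only [fejG_zero] at h2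
  have : 2 / Real.pi ^ 2 * Real.pi = 2 / Real.pi := by field_simp
  linarith

theorem fejL_exists : ∃ L : ℝ, 2 / Real.pi ≤ L ∧ (∀ y, fejG y ≤ L) ∧
    ∀ z, 0 < z → L ≤ fejG z + 2 / z := by
  have hb : ∀ z, 0 < z → ∀ y, fejG y ≤ fejG z + 2 / z := fun z hz y => by
    rcases le_total z y with h | h
    · exact fejG_tail hz h
    · have : 0 < 2 / z := by positivity
      linarith [fejG_mono h]
  have hbd : BddAbove (Set.range fejG) :=
    ⟨fejG 1 + 2 / 1, by rintro _ ⟨y, rfl⟩; exact hb 1 one_pos y⟩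
  exact ⟨⨆ y, fejG y, fejG_pi.trans (le_ciSup hbd _), le_ciSup hbd,
    fun z hz => ciSup_le (hb z hz)⟩

theorem fej_telescope (H : ℝ → ℝ) (x : ℝ) (N : ℕ) :
    ∑ j ∈ Finset.Icc (-(N : ℤ)) (N : ℤ), (H (x - j + 1 / 2) - H (x - j - 1 / 2))
      = H (x + N + 1 / 2) - H (x - N - 1 / 2) := by
  induction N with
  | zero => simp
  | succ n ih =>
    have e : Finset.Icc (-((n + 1 : ℕ) : ℤ)) ((n + 1 : ℕ) : ℤ)
        = insert (-((n + 1 : ℕ) : ℤ)) (insert ((n + 1 : ℕ) : ℤ)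
          (Finset.Icc (-(n : ℤ)) (n : ℤ))) := by
      ext j; simp only [Finset.mem_Icc, Finset.mem_insert]; push_cast; omega
    rw [e, Finset.sum_insert, Finset.sum_insert, ih]
    · push_cast
      have e1 : x - (n + 1) + 1 / 2 = x - n - 1 / 2 := by ring
      have e2 : x - -((n:ℝ) + 1) - 1 / 2 = x + n + 1 / 2 := by ring
      have e3 : x - -((n:ℝ) + 1) + 1 / 2 = x + (n + 1) + 1 / 2 := by ring
      have e4 : x - (-1 + -(n:ℝ)) - 1 / 2 = x + n + 1 / 2 := by ring
      have e5 : x - (-1 + -(n:ℝ)) + 1 / 2 = x + (n + 1) + 1 / 2 := by ring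
      try rw [e1, e2, e3]
      try ring
    · simp only [Finset.mem_Icc]; push_cast; omega
    · simp only [Finset.mem_Icc, Finset.mem_insert]; push_cast; omega

theorem fej_iteratedDeriv (C A : ℝ) (m : ℕ) :
    iteratedDeriv (m + 1) (fun x => C * (fejG (A * (x + 1 / 2)) - fejG (A * (x - 1 / 2))))
      = fun x => C * A ^ (m + 1) *
        (fejF m (A * (x + 1 / 2)) - fejF m (A * (x - 1 / 2))) := by
  have ha : ∀ c x : ℝ, HasDerivAt (fun x : ℝ => A * (x + c)) A x := fun c x => by
    simpa using ((hasDerivAt_id x).add_const c).const_mul A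
  have hs : ∀ c x : ℝ, HasDerivAt (fun x : ℝ => A * (x - c)) A x := fun c x => by
    simpa using ((hasDerivAt_id x).sub_const c).const_mul A
  induction m with
  | zero =>
    rw [iteratedDeriv_succ, iteratedDeriv_zero]
    ext x
    have h1 := (fejG_hasDerivAt (A * (x + 1 / 2))).comp x (ha (1 / 2) x)
    have h2 := (fejG_hasDerivAt (A * (x - 1 / 2))).comp x (hs (1 / 2) x)
    refine ((h1.sub h2).const_mul C).deriv.trans ?_
    ring
  | succ m ih =>
    rw [iteratedDeriv_succ, ih]
    ext x
    have h1 := (fejF_hasDerivAt m (A * (x + 1 / 2))).comp x (ha (1 / 2) x)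
    have h2 := (fejF_hasDerivAt m (A * (x - 1 / 2))).comp x (hs (1 / 2) x)
    refine ((h1.sub h2).const_mul (C * A ^ (m + 1))).deriv.trans ?_
    ring

theorem fej_differentiable (f : ℝ → ℝ) (hf : Differentiable ℝ f) (C A : ℝ) :
    Differentiable ℝ (fun x => C * (f (A * (x + 1 / 2)) - f (A * (x - 1 / 2)))) := by
  fun_prop

/-- Harper's approximation result (partition of unity).  For all large `N`
and small `δ > 0`, there are functions `g` and `g_{N+1}` with: (i) the translates
`g_j(x) = g(x − j)` for `|j| ≤ N` together with `g_{N+1}` form a partition of unity;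
(ii) `g ≥ 0` and `g(x) ≤ δ` for `|x| > 1`; (iii) `g_{N+1} ≥ 0` and `g_{N+1}(x) ≤ δ` for
`|x| ≤ N`; (iv) `g` is smooth with `|g^{(ℓ)}(x)| ≤ (2π/δ)^{ℓ+1}/(π(ℓ+1))` for `ℓ ≥ 1`. -/
theorem approximation_result_one :
    ∃ N0 : ℕ, ∃ δ0 : ℝ, 0 < δ0 ∧
      ∀ N : ℕ, N0 ≤ N → ∀ δ : ℝ, 0 < δ → δ ≤ δ0 →
        ∃ g gN1 : ℝ → ℝ,
          (∀ x : ℝ, (∑ j ∈ Finset.Icc (-(N : ℤ)) (N : ℤ), g (x - (j : ℝ))) + gN1 x = 1) ∧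
          (∀ x : ℝ, 0 ≤ g x) ∧ (∀ x : ℝ, 1 < |x| → g x ≤ δ) ∧
          (∀ x : ℝ, 0 ≤ gN1 x) ∧ (∀ x : ℝ, |x| ≤ (N : ℝ) → gN1 x ≤ δ) ∧
          ContDiff ℝ (⊤ : ℕ∞) g ∧
          (∀ ℓ : ℕ, 1 ≤ ℓ → ∀ x : ℝ,
            |iteratedDeriv ℓ g x| ≤ (1 / (Real.pi * (ℓ + 1))) * (2 * Real.pi / δ) ^ (ℓ + 1)) := by

  obtain ⟨L, hL, hGL, hLG⟩ := fejL_exists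
  have hpi := Real.pi_pos
  have hL0 : 0 < L := lt_of_lt_of_le (by positivity) hL
  refine ⟨0, 1, one_pos, fun N _ δ hδ hδ1 => ?_⟩
  set A : ℝ := 2 * Real.pi / δ with hA
  have hA0 : 0 < A := by positivity
  set C : ℝ := 1 / (2 * L) with hC
  have hC0 : 0 < C := by positivity
  have hCL : C * L = 1 / 2 := by rw [hC]; field_simp
  have hCpi : C ≤ Real.pi / 4 := by
    rw [hC, div_le_iff₀ (by positivity)]
    rw [div_le_iff₀ hpi] at hL
    linarith
  have hGneg : ∀ y, -L ≤ fejG y := fun y => by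
    have := hGL (-y)
    rw [fejG_odd] at this; linarith
  have htail : C * (L - fejG (A * (1 / 2))) ≤ δ / 2 := by
    have h := hLG (A * (1 / 2)) (by positivity)
    have e : 2 / (A * (1 / 2)) = 2 * δ / Real.pi := by rw [hA]; field_simp
    rw [e] at h
    calc C * (L - fejG (A * (1 / 2))) ≤ C * (2 * δ / Real.pi) :=
          mul_le_mul_of_nonneg_left (by linarith) hC0.le
      _ ≤ Real.pi / 4 * (2 * δ / Real.pi) :=
          mul_le_mul_of_nonneg_right hCpi (by positivity)
      _ = δ / 2 := by field_simp; ring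
  have hge : ∀ y, 1 / 2 ≤ y → fejG (A * (1 / 2)) ≤ fejG (A * y) := fun y hy =>
    fejG_mono (mul_le_mul_of_nonneg_left hy hA0.le)
  have hle : ∀ y, y ≤ -(1 / 2) → fejG (A * y) ≤ - fejG (A * (1 / 2)) := fun y hy => by
    rw [← fejG_odd, ← mul_neg]
    exact fejG_mono (mul_le_mul_of_nonneg_left hy hA0.le)
  refine ⟨fun x => C * (fejG (A * (x + 1 / 2)) - fejG (A * (x - 1 / 2))),
    fun x => 1 - C * (fejG (A * (x + N + 1 / 2)) - fejG (A * (x - N - 1 / 2))),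
    ?_, ?_, ?_, ?_, ?_, ?_, ?_⟩
  · intro x
    simp only
    rw [← Finset.mul_sum, fej_telescope (fun y => fejG (A * y)) x N]
    ring
  · intro x
    have := fejG_mono (mul_le_mul_of_nonneg_left (by linarith : x - 1 / 2 ≤ x + 1 / 2) hA0.le)
    exact mul_nonneg hC0.le (by linarith)
  · intro x hx
    have key : fejG (A * (x + 1 / 2)) - fejG (A * (x - 1 / 2)) ≤ L - fejG (A * (1 / 2)) := by
      rcases lt_abs.1 hx with h | h
      · linarith [hge (x - 1 / 2) (by linarith), hGL (A * (x + 1 / 2))]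
      · linarith [hle (x + 1 / 2) (by linarith), hGneg (A * (x - 1 / 2))]
    have := mul_le_mul_of_nonneg_left key hC0.le
    simp only
    linarith
  · intro x
    have key : fejG (A * (x + N + 1 / 2)) - fejG (A * (x - N - 1 / 2)) ≤ 2 * L := by
      linarith [hGL (A * (x + N + 1 / 2)), hGneg (A * (x - N - 1 / 2))]
    have := mul_le_mul_of_nonneg_left key hC0.le
    simp only
    linarith
  · intro x hx
    rw [abs_le] at hx
    have key : 2 * fejG (A * (1 / 2)) ≤
        fejG (A * (x + N + 1 / 2)) - fejG (A * (x - N - 1 / 2)) := by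
      linarith [hge (x + N + 1 / 2) (by linarith [hx.1]), hle (x - N - 1 / 2) (by linarith [hx.2])]
    have := mul_le_mul_of_nonneg_left key hC0.le
    simp only
    linarith
  · apply contDiff_of_differentiable_iteratedDeriv
    intro m _
    cases m with
    | zero =>
      rw [iteratedDeriv_zero]
      exact fej_differentiable _ (fun x => (fejG_hasDerivAt x).differentiableAt) C A
    | succ m =>
      rw [fej_iteratedDeriv]
      exact fej_differentiable _ (fun x => (fejF_hasDerivAt m x).differentiableAt) _ A
  · intro l hl x
    obtain ⟨m, rfl⟩ : ∃ m, l = m + 1 := ⟨l - 1, by omega⟩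
    rw [fej_iteratedDeriv]
    simp only
    rw [abs_mul, abs_of_pos (by positivity : 0 < C * A ^ (m + 1))]
    have hm : (0:ℝ) ≤ m := Nat.cast_nonneg m
    have h1 : |fejF m (A * (x + 1 / 2)) - fejF m (A * (x - 1 / 2))|
        ≤ 2 * (1 / ((m + 1) * (m + 2))) := by
      refine (abs_sub _ _).trans ?_
      linarith [fejF_abs_le m (A * (x + 1 / 2)), fejF_abs_le m (A * (x - 1 / 2))]
    have h2 : 1 / (((m:ℝ) + 1) * (m + 2)) ≤ 1 / (m + 2) :=
      one_div_le_one_div_of_le (by positivity) (by nlinarith)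
    have h3 : C * 2 ≤ A / Real.pi := by
      have : A / Real.pi = 2 / δ := by rw [hA]; field_simp
      rw [this]
      have : 2 ≤ 2 / δ := by rw [le_div_iff₀ hδ]; linarith
      linarith [Real.pi_le_four]
    calc C * A ^ (m + 1) * |fejF m (A * (x + 1 / 2)) - fejF m (A * (x - 1 / 2))|
        ≤ C * A ^ (m + 1) * (2 * (1 / (m + 2))) :=
          mul_le_mul_of_nonneg_left (by linarith) (by positivity)
      _ = (C * 2) * (A ^ (m + 1) * (1 / (m + 2))) := by ring
      _ ≤ A / Real.pi * (A ^ (m + 1) * (1 / (m + 2))) :=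
          mul_le_mul_of_nonneg_right h3 (by positivity)
      _ = 1 / (Real.pi * (((m + 1 : ℕ) : ℝ) + 1)) * A ^ (m + 1 + 1) := by
          push_cast
          have : (m:ℝ) + 1 + 1 = m + 2 := by ring
          rw [this]
          field_simp
          ring
end

section
/- For every ε ∈ (0, 1/4] there is a constant C(ε) such that for all reals K ≥ 1 and M ≥ 1, and all positive integers m1, m2 with 1/K ≤ m1/m2 ≤ K, the sum over quadruples of positive integers (d1, d2, n1, n2) satisfying d1²·m1·n1 = d2²·m2·n2 and max(d1, d2) > M of (d1²·n1)^{−(1/2+ε)} · (d2²·n2)^{−(1/2+ε)} is at most C(ε) · K / M. -/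
lemma divisor_count_bound (δ : ℝ) (hδ : 0 < δ) :
    ∃ C : ℝ, 0 < C ∧ ∀ n : ℕ, 0 < n → (n.divisors.card : ℝ) ≤ C * (n : ℝ) ^ δ := by
  set A : ℝ := max 1 (1 / (δ * Real.log 2)) with hA
  have hA1 : 1 ≤ A := le_max_left _ _
  have hl : 0 < δ * Real.log 2 := mul_pos hδ (Real.log_pos (by norm_num))
  obtain ⟨P, hP⟩ := exists_nat_ge ((2 : ℝ) ^ (1 / δ))
  have key : ∀ p e : ℕ, 2 ≤ p →
      ((e : ℝ) + 1) ≤ (if p < P then A else 1) * ((p : ℝ) ^ e) ^ δ := by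
    intro p e hp
    have hp0 : (0 : ℝ) ≤ p := by positivity
    have hp2 : (2 : ℝ) ≤ p := by exact_mod_cast hp
    split_ifs with h
    · have h1 : ((2 : ℝ) ^ e) ^ δ ≤ ((p : ℝ) ^ e) ^ δ := by gcongr
      have h2 : ((2 : ℝ) ^ e) ^ δ = Real.exp (e * (δ * Real.log 2)) := by
        rw [Real.rpow_def_of_pos (by positivity), Real.log_pow]
        congr 1; ring
      have h3 := Real.add_one_le_exp ((e : ℝ) * (δ * Real.log 2))
      have h4 : 1 ≤ A * (δ * Real.log 2) := by
        have : 1 / (δ * Real.log 2) ≤ A := le_max_right _ _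
        rwa [div_le_iff₀ hl] at this
      have h5 : A * ((e : ℝ) * (δ * Real.log 2) + 1) ≤ A * ((p : ℝ) ^ e) ^ δ := by
        apply mul_le_mul_of_nonneg_left _ (by linarith)
        linarith
      have h6 : (e : ℝ) * 1 ≤ e * (A * (δ * Real.log 2)) := by gcongr
      nlinarith
    · push Not at h
      have hpP : (2 : ℝ) ^ (1 / δ) ≤ p := hP.trans (by exact_mod_cast h)
      have h1 : (2 : ℝ) ≤ (p : ℝ) ^ δ := by
        calc (2 : ℝ) = ((2 : ℝ) ^ (1 / δ)) ^ δ := by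
              rw [← Real.rpow_mul (by norm_num), one_div_mul_cancel hδ.ne', Real.rpow_one]
          _ ≤ _ := by gcongr
      have h2 : ((p : ℝ) ^ e) ^ δ = ((p : ℝ) ^ δ) ^ e := by
        rw [← Real.rpow_natCast, ← Real.rpow_mul hp0, mul_comm, Real.rpow_mul hp0,
          Real.rpow_natCast]
      rw [one_mul, h2]
      calc (e : ℝ) + 1 ≤ (2 : ℝ) ^ e := by
            exact_mod_cast Nat.lt_two_pow_self (n := e)
        _ ≤ _ := by gcongr
  refine ⟨A ^ P, by positivity, fun n hn => ?_⟩
  rw [Nat.card_divisors hn.ne']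
  push_cast
  calc ∏ p ∈ n.primeFactors, ((n.factorization p : ℝ) + 1)
      ≤ ∏ p ∈ n.primeFactors,
        ((if p < P then A else 1) * ((p : ℝ) ^ (n.factorization p)) ^ δ) := by
        apply Finset.prod_le_prod
        · intros; positivity
        · intro p hp
          exact key p _ (Nat.prime_of_mem_primeFactors hp).two_le
    _ = (∏ p ∈ n.primeFactors, (if p < P then A else 1)) * (n : ℝ) ^ δ := by
        rw [Finset.prod_mul_distrib]
        congr 1
        rw [Real.finsetProd_rpow _ _ (fun i _ => by positivity)]
        congr 1
        have := Nat.prod_factorization_pow_eq_self hn.ne'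
        rw [Finsupp.prod, Nat.support_factorization] at this
        exact_mod_cast this
    _ ≤ A ^ P * (n : ℝ) ^ δ := by
        gcongr
        rw [Finset.prod_ite]
        simp only [Finset.prod_const, one_pow, mul_one]
        apply pow_le_pow_right₀ hA1
        calc _ ≤ (Finset.range P).card := Finset.card_le_card (by
              intro x hx; simp at hx ⊢; exact hx.2)
          _ = P := by simp

open scoped Classical in
lemma fiber_bound (ε : ℝ) (hε0 : 0 < ε) :
    ∃ D : ℝ, 0 < D ∧ ∀ K : ℝ, 1 ≤ K → ∀ m1 m2 : ℕ, 0 < m1 → 0 < m2 →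
      (m2 : ℝ) / (m1 : ℝ) ≤ K → ∀ p : ℕ × ℕ,
      (∑' r : ℕ × ℕ, if 0 < p.1 ∧ 0 < r.1 ∧ 0 < p.2 ∧ 0 < r.2 ∧
          p.1 ^ 2 * m1 * p.2 = r.1 ^ 2 * m2 * r.2 then
        ENNReal.ofReal ((p.1 : ℝ) * (((p.1 ^ 2 * p.2 : ℕ) : ℝ) ^ (-(1 / 2 + ε)) *
          ((r.1 ^ 2 * r.2 : ℕ) : ℝ) ^ (-(1 / 2 + ε)))) else 0)
      ≤ ENNReal.ofReal (D * K * ((p.1 : ℝ) ^ (-(1 + 2 * ε)) * (p.2 : ℝ) ^ (-(1 + ε)))) := by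
  obtain ⟨D, hD, hdiv⟩ := divisor_count_bound ε hε0
  refine ⟨D, hD, fun K hK m1 m2 hm1 hm2 hmK p => ?_⟩
  by_cases hex : ∃ r : ℕ × ℕ, 0 < p.1 ∧ 0 < r.1 ∧ 0 < p.2 ∧ 0 < r.2 ∧
          p.1 ^ 2 * m1 * p.2 = r.1 ^ 2 * m2 * r.2
  swap
  · push Not at hex
    rw [ENNReal.tsum_eq_zero.mpr]
    · exact zero_le
    · intro r
      rw [if_neg]
      rintro ⟨a, b, c, d, e⟩
      exact hex r a b c d e
  obtain ⟨⟨x, y⟩, hp1, hx, hp2, hy, hxy⟩ := hex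
  obtain ⟨d, n⟩ := p
  simp only at hp1 hx hp2 hy hxy ⊢
  set b := x ^ 2 * y with hb
  have hb0 : 0 < b := by positivity
  have hr : ∀ r : ℕ × ℕ, d ^ 2 * m1 * n = r.1 ^ 2 * m2 * r.2 → r.1 ^ 2 * r.2 = b := by
    intro r h
    apply Nat.eq_of_mul_eq_mul_left hm2
    rw [hb]; linarith
  set X : ℝ := (d : ℝ) * (((d ^ 2 * n : ℕ) : ℝ) ^ (-(1 / 2 + ε)) * (b : ℝ) ^ (-(1 / 2 + ε)))
    with hX
  have hX0 : 0 ≤ X := by positivity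
  set S : Finset (ℕ × ℕ) := b.divisors.image (fun e => (e, b / e ^ 2)) with hS
  rw [tsum_eq_sum (s := S)]
  swap
  · intro r hrS
    rw [if_neg]
    rintro ⟨-, h1, -, h2, h3⟩
    apply hrS
    have := hr r h3
    rw [hS, Finset.mem_image]
    refine ⟨r.1, ?_, ?_⟩
    · rw [Nat.mem_divisors]
      exact ⟨⟨r.1 * r.2, by rw [← this]; ring⟩, hb0.ne'⟩
    · ext
      · rfl
      · simp only
        rw [← this, Nat.mul_div_cancel_left _ (by positivity)]
  calc _ ≤ ∑ r ∈ S, ENNReal.ofReal X := by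
        apply Finset.sum_le_sum
        intro r _
        split_ifs with h
        · rw [hr r h.2.2.2.2]
        · exact zero_le
    _ = ENNReal.ofReal (S.card * X) := by
        rw [Finset.sum_const, nsmul_eq_mul, ENNReal.ofReal_mul (p := (S.card : ℝ)) (by positivity),
          ENNReal.ofReal_natCast]
    _ ≤ _ := by
        apply ENNReal.ofReal_le_ofReal
        have hc : (S.card : ℝ) ≤ D * (b : ℝ) ^ ε :=
          le_trans (by exact_mod_cast Finset.card_image_le) (hdiv b hb0)
        have hbR : (0 : ℝ) < b := by exact_mod_cast hb0
        have hdR : (0 : ℝ) < d := by exact_mod_cast hp1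
        have hnR : (0 : ℝ) < n := by exact_mod_cast hp2
        set a : ℝ := ((d ^ 2 * n : ℕ) : ℝ) with ha
        have haR : a = (d : ℝ) ^ 2 * n := by rw [ha]; push_cast; ring
        have ha0 : 0 < a := by rw [haR]; positivity
        have hm1R : (0 : ℝ) < m1 := by exact_mod_cast hm1
        have hab : a ≤ K * b := by
          have h1 : (m1 : ℝ) * a = m2 * b := by
            rw [ha]
            have : m1 * (d ^ 2 * n) = m2 * b := by rw [hb]; linarith
            exact_mod_cast this
          have h2 : a = m2 / m1 * b := by field_simp; linarith
          rw [h2]; gcongr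
        have hb2 : (b : ℝ) ^ (-(1 / 2 : ℝ)) ≤ K * a ^ (-(1 / 2 : ℝ)) := by
          rw [Real.rpow_neg hbR.le, Real.rpow_neg ha0.le, ← div_eq_mul_inv,
            le_div_iff₀ (by positivity), inv_mul_le_iff₀ (by positivity)]
          calc a ^ (1 / 2 : ℝ) ≤ (K * b) ^ (1 / 2 : ℝ) := by gcongr
            _ = K ^ (1 / 2 : ℝ) * (b : ℝ) ^ (1 / 2 : ℝ) := Real.mul_rpow (by linarith) hbR.le
            _ ≤ K ^ (1 : ℝ) * (b : ℝ) ^ (1 / 2 : ℝ) := by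
              gcongr
              norm_num
            _ = _ := by rw [Real.rpow_one]; ring
        calc S.card * X ≤ D * (b : ℝ) ^ ε * X := by gcongr
          _ = D * d * a ^ (-(1 / 2 + ε)) * (b : ℝ) ^ (-(1 / 2 : ℝ)) := by
            have : (b : ℝ) ^ (-(1 / 2 : ℝ)) = (b : ℝ) ^ ε * (b : ℝ) ^ (-(1 / 2 + ε)) := by
              rw [← Real.rpow_add hbR]; congr 1; ring
            rw [this, hX]; ring
          _ ≤ D * d * a ^ (-(1 / 2 + ε)) * (K * a ^ (-(1 / 2 : ℝ))) := by gcongr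
          _ = D * K * (d * a ^ (-(1 + ε))) := by
            have : a ^ (-(1 + ε)) = a ^ (-(1 / 2 + ε)) * a ^ (-(1 / 2 : ℝ)) := by
              rw [← Real.rpow_add ha0]; congr 1; ring
            rw [this]; ring
          _ = _ := by
            congr 1
            rw [haR, Real.mul_rpow (by positivity) hnR.le, ← mul_assoc]
            congr 1
            rw [← Real.rpow_natCast, ← Real.rpow_mul hdR.le]
            nth_rewrite 1 [← Real.rpow_one (d : ℝ)]
            rw [← Real.rpow_add hdR]
            congr 1
            push_cast; ring

open scoped Classical in
lemma core_bound (ε : ℝ) (hε0 : 0 < ε) :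
    ∃ C : ℝ, 0 < C ∧ ∀ K : ℝ, 1 ≤ K → ∀ m1 m2 : ℕ, 0 < m1 → 0 < m2 →
      (m2 : ℝ) / (m1 : ℝ) ≤ K →
      (∑' p : ℕ × ℕ, ∑' r : ℕ × ℕ, if 0 < p.1 ∧ 0 < r.1 ∧ 0 < p.2 ∧ 0 < r.2 ∧
          p.1 ^ 2 * m1 * p.2 = r.1 ^ 2 * m2 * r.2 then
        ENNReal.ofReal ((p.1 : ℝ) * (((p.1 ^ 2 * p.2 : ℕ) : ℝ) ^ (-(1 / 2 + ε)) *
          ((r.1 ^ 2 * r.2 : ℕ) : ℝ) ^ (-(1 / 2 + ε)))) else 0)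
      ≤ ENNReal.ofReal (C * K) := by
  obtain ⟨D, hD, h⟩ := fiber_bound ε hε0
  set F : ℕ × ℕ → ℝ := fun p => (p.1 : ℝ) ^ (-(1 + 2 * ε)) * (p.2 : ℝ) ^ (-(1 + ε)) with hF
  have hs : Summable F := by
    apply Summable.mul_of_nonneg
      (f := fun n : ℕ => (n : ℝ) ^ (-(1 + 2 * ε))) (g := fun n : ℕ => (n : ℝ) ^ (-(1 + ε)))
    · exact Real.summable_nat_rpow.mpr (by linarith)
    · exact Real.summable_nat_rpow.mpr (by linarith)
    · intro n; positivity
    · intro n; positivity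
  have hF0 : ∀ p, 0 ≤ F p := fun p => by simp only [hF]; positivity
  have hT : 0 ≤ ∑' p, F p := tsum_nonneg hF0
  refine ⟨D * (∑' p, F p + 1), by positivity, fun K hK m1 m2 hm1 hm2 hmK => ?_⟩
  have hK0 : 0 < K := by linarith
  refine (ENNReal.tsum_le_tsum (h K hK m1 m2 hm1 hm2 hmK)).trans ?_
  rw [← ENNReal.ofReal_tsum_of_nonneg (fun p => mul_nonneg (by positivity) (hF0 p))
    (hs.mul_left _), tsum_mul_left]
  apply ENNReal.ofReal_le_ofReal
  have : 0 < D * K := by positivity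
  show D * K * (∑' p, F p) ≤ _
  nlinarith

def quadEquiv : ((ℕ × ℕ) × (ℕ × ℕ)) ≃ (ℕ × ℕ × ℕ × ℕ) where
  toFun z := (z.1.1, z.2.1, z.1.2, z.2.2)
  invFun q := ((q.1, q.2.2.1), (q.2.1, q.2.2.2))
  left_inv _ := rfl
  right_inv _ := rfl


open scoped Classical in
/-- the tail bound for the quadruple sum.  For `ε ∈ (0, 1/4]` there is
`C(ε)` such that for `K, M ≥ 1` and positive integers `m1, m2` with
`1/K ≤ m1/m2 ≤ K`, the sum over positive `(d1, d2, n1, n2)` with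
`d1² m1 n1 = d2² m2 n2` and `max(d1, d2) > M` of
`(d1² n1)^{−(1/2+ε)} (d2² n2)^{−(1/2+ε)}` is at most `C(ε) K / M`. -/
theorem quadruple_tail_sum_bound (ε : ℝ) (hε0 : 0 < ε) (hε : ε ≤ 1 / 4) :
    ∃ C : ℝ, 0 < C ∧
      ∀ K M : ℝ, 1 ≤ K → 1 ≤ M → ∀ m1 m2 : ℕ, 0 < m1 → 0 < m2 →
        1 / K ≤ (m1 : ℝ) / (m2 : ℝ) → (m1 : ℝ) / (m2 : ℝ) ≤ K →
        (∑' q : ℕ × ℕ × ℕ × ℕ,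
          if 0 < q.1 ∧ 0 < q.2.1 ∧ 0 < q.2.2.1 ∧ 0 < q.2.2.2 ∧
              q.1 ^ 2 * m1 * q.2.2.1 = q.2.1 ^ 2 * m2 * q.2.2.2 ∧
              M < (max q.1 q.2.1 : ℕ) then
            ((q.1 ^ 2 * q.2.2.1 : ℕ) : ℝ) ^ (-(1 / 2 + ε)) *
              ((q.2.1 ^ 2 * q.2.2.2 : ℕ) : ℝ) ^ (-(1 / 2 + ε))
          else 0) ≤ C * K / M := by
  obtain ⟨C, hC, h⟩ := core_bound ε hε0
  refine ⟨2 * C, by positivity, fun K M hK hM m1 m2 hm1 hm2 hK1 hK2 => ?_⟩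
  have hM0 : 0 < M := by linarith
  have hK0 : 0 < K := by linarith
  have hm1R : (0 : ℝ) < m1 := by exact_mod_cast hm1
  have hm2R : (0 : ℝ) < m2 := by exact_mod_cast hm2
  have hK3 : (m2 : ℝ) / m1 ≤ K := by
    rw [div_le_div_iff₀ hK0 hm2R] at hK1
    rw [div_le_iff₀ hm1R]; linarith
  set f : ℕ × ℕ × ℕ × ℕ → ℝ := fun q =>
    if 0 < q.1 ∧ 0 < q.2.1 ∧ 0 < q.2.2.1 ∧ 0 < q.2.2.2 ∧
              q.1 ^ 2 * m1 * q.2.2.1 = q.2.1 ^ 2 * m2 * q.2.2.2 ∧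
              M < (max q.1 q.2.1 : ℕ) then
            ((q.1 ^ 2 * q.2.2.1 : ℕ) : ℝ) ^ (-(1 / 2 + ε)) *
              ((q.2.1 ^ 2 * q.2.2.2 : ℕ) : ℝ) ^ (-(1 / 2 + ε))
          else 0 with hf
  have hf0 : ∀ q, 0 ≤ f q := by
    intro q; simp only [hf]; split_ifs <;> positivity
  have hB0 : 0 ≤ 2 * C * K / M := by positivity
  have hmain : ∑' q, ENNReal.ofReal (f q) ≤ ENNReal.ofReal (2 * C * K / M) := by
    have h1 := h K hK m1 m2 hm1 hm2 hK3
    have h2 := h K hK m2 m1 hm2 hm1 hK2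
    rw [ENNReal.tsum_comm] at h2
    have h3 := add_le_add h1 h2
    rw [← ENNReal.tsum_add] at h3
    simp_rw [← ENNReal.tsum_add] at h3
    rw [← ENNReal.ofReal_add (by positivity) (by positivity)] at h3
    have h4 := mul_le_mul_right h3 (ENNReal.ofReal (1 / M))
    rw [← ENNReal.ofReal_mul (by positivity)] at h4
    have h5 : 1 / M * (C * K + C * K) = 2 * C * K / M := by ring
    rw [h5] at h4
    refine le_trans ?_ h4
    rw [← quadEquiv.tsum_eq, ENNReal.tsum_prod', ← ENNReal.tsum_mul_left]
    refine ENNReal.tsum_le_tsum fun p => ?_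
    rw [← ENNReal.tsum_mul_left]
    refine ENNReal.tsum_le_tsum fun r => ?_
    simp only [hf, quadEquiv, Equiv.coe_fn_mk]
    by_cases hc : 0 < p.1 ∧ 0 < r.1 ∧ 0 < p.2 ∧ 0 < r.2 ∧
          p.1 ^ 2 * m1 * p.2 = r.1 ^ 2 * m2 * r.2 ∧ M < (max p.1 r.1 : ℕ)
    · obtain ⟨c1, c2, c3, c4, c5, c6⟩ := hc
      rw [if_pos ⟨c1, c2, c3, c4, c5, c6⟩, if_pos ⟨c1, c2, c3, c4, c5⟩,
        if_pos ⟨c2, c1, c4, c3, c5.symm⟩, ← ENNReal.ofReal_add (by positivity) (by positivity),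
        ← ENNReal.ofReal_mul (by positivity)]
      apply ENNReal.ofReal_le_ofReal
      set u := ((p.1 ^ 2 * p.2 : ℕ) : ℝ) ^ (-(1 / 2 + ε))
      set v := ((r.1 ^ 2 * r.2 : ℕ) : ℝ) ^ (-(1 / 2 + ε))
      have huv : 0 ≤ u * v := by positivity
      have hle : M ≤ (p.1 : ℝ) + r.1 := by
        refine c6.le.trans ?_
        exact_mod_cast max_le (Nat.le_add_right _ _) (Nat.le_add_left _ _)
      have e : 1 / M * (p.1 * (u * v) + r.1 * (v * u)) = (u * v * ((p.1 : ℝ) + r.1)) / M := by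
        ring
      rw [e, le_div_iff₀ hM0]
      exact mul_le_mul_of_nonneg_left hle huv
    · rw [if_neg hc, ENNReal.ofReal_zero]
      exact zero_le
  have ht := ENNReal.tsum_toReal_eq (f := fun q => ENNReal.ofReal (f q))
    (fun _ => ENNReal.ofReal_ne_top)
  simp only [ENNReal.toReal_ofReal (hf0 _)] at ht
  rw [← ht]
  exact ENNReal.toReal_le_of_le_ofReal hB0 hmain
end
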